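/- Let A be the monomial algebra on 13 generators defined below and K the trivial A-module. Then Extᴬⁿ(K,K) = 0 for all n ≥ 7. -/

import Mathlib

/-!
Let `K` be a field and `V` a 13-dimensional `K`-vector space with basis
`{m,n,p,q,r,s,t,u,v,w,x,y,z}`.  Let `A = T(V)/I` be the quotient of the free
(tensor) algebra on `V` by the two-sided ideal generated by the nine monomials
`mn²p, n²pqr, npqrs, pqrst, stu, tuvwx, uvwxy, vwxy², xy²z`, and regard `K` as
the trivial left `A`-module via the augmentation sending every generator to `0`.
-/

open CategoryTheory

/-- The thirteen generators `m,n,p,q,r,s,t,u,v,w,x,y,z` of the algebra `A`. -/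
inductive Gen : Type
  | m | n | p | q | r | s | t | u | v | w | x | y | z

variable (K : Type) [Field K]

open Gen

/-- The generator `i`, as an element of the tensor algebra `T(V)`. -/
noncomputable def g (i : Gen) : FreeAlgebra K Gen := FreeAlgebra.ι K i

/-- The relation identifying each of the nine defining monomials with `0`;
the quotient of `T(V)` by this relation is exactly `T(V)/I` where `I` is the
two-sided ideal generated by the nine monomials. -/
inductive MonRel : FreeAlgebra K Gen → FreeAlgebra K Gen → Prop
  | mnnp : MonRel (g K m * g K n * g K n * g K p) 0
  | nnpqr : MonRel (g K n * g K n * g K p * g K q * g K r) 0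
  | npqrs : MonRel (g K n * g K p * g K q * g K r * g K s) 0
  | pqrst : MonRel (g K p * g K q * g K r * g K s * g K t) 0
  | stu : MonRel (g K s * g K t * g K u) 0
  | tuvwx : MonRel (g K t * g K u * g K v * g K w * g K x) 0
  | uvwxy : MonRel (g K u * g K v * g K w * g K x * g K y) 0
  | vwxyy : MonRel (g K v * g K w * g K x * g K y * g K y) 0
  | xyyz : MonRel (g K x * g K y * g K y * g K z) 0

/-- The monomial algebra `A = T(V)/I`. -/
noncomputable abbrev A : Type := RingQuot (MonRel K)

/-- The augmentation `A →ₐ[K] K`, sending every generator to `0`. -/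
noncomputable def aug : A K →ₐ[K] K :=
  RingQuot.liftAlgHom K ⟨FreeAlgebra.lift K (fun _ => (0 : K)), by
    rintro x y h
    induction h <;> simp [g]⟩

/-- `K`, regarded as the trivial left `A`-module via the augmentation. -/
noncomputable def KMod : ModuleCat.{0} (A K) :=
  letI : Module (A K) K := Module.compHom K (aug K).toRingHom
  ModuleCat.of (A K) K

/-- The `K`-vector space `Extᴬⁿ(K, K)`. -/
noncomputable def extKK (n : ℕ) : ModuleCat K :=
  ((Ext K (ModuleCat.{0} (A K)) n).obj (Opposite.op (KMod K))).obj (KMod K)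

section General

open Limits

/-- `Ext R C m X Y`, defined by deriving `Hom(-, Y)`, vanishes in positive degrees `m` which are
not less than a strict bound for the projective dimension of `X`. -/
theorem isZero_Ext_of_hasProjectiveDimensionLT {R C : Type*} [Ring R] [Category* C] [Abelian C]
    [Linear R C] [EnoughProjectives C] (X Y : C) (n m : ℕ) [HasProjectiveDimensionLT X n]
    (hm : n ≤ m + 1) : IsZero (((Ext R C (m + 1)).obj (Opposite.op X)).obj Y) := by
  let := HasExt.standard C
  let P := projectiveResolution X
  refine IsZero.of_iso ?_ (P.isoExt (m + 1) Y)
  rw [← HomologicalComplex.exactAt_iff_isZero_homology,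
    HomologicalComplex.exactAt_iff' _ m (m + 1) (m + 2) (by simp) (by simp),
    ShortComplex.moduleCat_exact_iff]
  intro (f : P.complex.X (m + 1) ⟶ Y) hf
  have hf' : P.complex.d (m + 2) (m + 1) ≫ f = 0 := hf
  have := HasProjectiveDimensionLT.subsingleton X n (m + 1) hm Y
  exact (P.extMk_eq_zero_iff f (m + 2) rfl hf' m rfl).1 (Subsingleton.elim _ _)

/-- The projective dimension of a sum of two independent submodules is bounded by the projective
dimensions of the summands. -/
theorem hasProjectiveDimensionLT_sup {R : Type} [Ring R] {M : Type} [AddCommGroup M] [Module R M]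
    (S T : Submodule R M) (h : Disjoint S T) (n : ℕ)
    [HasProjectiveDimensionLT (ModuleCat.of R S) n]
    [HasProjectiveDimensionLT (ModuleCat.of R T) n] :
    HasProjectiveDimensionLT (ModuleCat.of R ↥(S ⊔ T)) n := by
  have hinj : Function.Injective (S.subtype.coprod T.subtype) := by
    rw [← LinearMap.ker_eq_bot, LinearMap.ker_coprod_of_disjoint_range _ _ (by simpa using h)]
    simp
  have hrange : LinearMap.range (S.subtype.coprod T.subtype) = S ⊔ T := by
    simp [LinearMap.range_coprod]
  let e : (S × T) ≃ₗ[R] ↥(S ⊔ T) :=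
    (LinearEquiv.ofInjective _ hinj).trans (LinearEquiv.ofEq _ _ hrange)
  exact hasProjectiveDimensionLT_of_iso
    (ModuleCat.biprodIsoProd (ModuleCat.of R S) (ModuleCat.of R T) ≪≫ e.toModuleIso) n

theorem hasProjectiveDimensionLT_of_ker {R : Type} [Ring R] {M N : Type} [AddCommGroup M]
    [Module R M] [AddCommGroup N] [Module R N] [Module.Projective R M] (f : M →ₗ[R] N)
    (hf : Function.Surjective f) (n : ℕ)
    (h : HasProjectiveDimensionLT (ModuleCat.of R (LinearMap.ker f)) n) :
    HasProjectiveDimensionLT (ModuleCat.of R N) (n + 1) := by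
  have : Projective (ModuleCat.of R M) := IsProjective.iff_projective M |>.1 inferInstance
  exact (LinearMap.shortExact_shortComplexKer hf).hasProjectiveDimensionLT_X₃ n h
    (hasProjectiveDimensionLT_of_ge (ModuleCat.of R M) 1 (n + 1) (by lia))

end General

namespace MonomialAlgebra

instance : DecidableEq Gen := fun a b =>
  decidable_of_iff (a.ctorIdx = b.ctorIdx) ⟨by cases a <;> cases b <;> simp [Gen.ctorIdx], by
    rintro rfl; rfl⟩

/-- The nine defining monomials, as words in the generators. -/
def relations : List (List Gen) :=
  [[m, n, n, p], [n, n, p, q, r], [n, p, q, r, s], [p, q, r, s, t], [s, t, u], [t, u, v, w, x],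
    [u, v, w, x, y], [v, w, x, y, y], [x, y, y, z]]

/-- A word vanishes if it contains one of the defining monomials. -/
def Vanishes (l : List Gen) : Prop := ∃ r ∈ relations, r <:+: l

instance (l : List Gen) : Decidable (Vanishes l) :=
  inferInstanceAs (Decidable (∃ r ∈ relations, r <:+: l))

theorem Vanishes.mono {l l' : List Gen} (h : Vanishes l) (hl : l <:+: l') : Vanishes l' :=
  h.imp fun _ hr => ⟨hr.1, hr.2.trans hl⟩

/-- The image in `A` of a generator. -/
noncomputable def gen (i : Gen) : A K := RingQuot.mkAlgHom K (MonRel K) (g K i)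

/-- The image in `A` of a word. -/
noncomputable def word (l : List Gen) : A K := (l.map (gen K)).prod

@[simp] theorem word_nil : word K [] = 1 := rfl

@[simp] theorem word_cons (i : Gen) (l : List Gen) : word K (i :: l) = gen K i * word K l := by
  simp [word]

theorem word_append (l l' : List Gen) : word K (l ++ l') = word K l * word K l' := by
  simp [word]

theorem word_eq_zero {l : List Gen} (h : Vanishes l) : word K l = 0 := by
  obtain ⟨r, hr, a, b, rfl⟩ := h
  suffices word K r = 0 by simp [word_append, this]
  simp only [relations, List.mem_cons, List.not_mem_nil, or_false] at hr
  have key {b : FreeAlgebra K Gen} (hb : MonRel K b 0) :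
      RingQuot.mkAlgHom K (MonRel K) b = 0 := by
    rw [RingQuot.mkAlgHom_rel K hb, map_zero]
  rcases hr with rfl | rfl | rfl | rfl | rfl | rfl | rfl | rfl | rfl
  · simpa [gen, mul_assoc] using key .mnnp
  · simpa [gen, mul_assoc] using key .nnpqr
  · simpa [gen, mul_assoc] using key .npqrs
  · simpa [gen, mul_assoc] using key .pqrst
  · simpa [gen, mul_assoc] using key .stu
  · simpa [gen, mul_assoc] using key .tuvwx
  · simpa [gen, mul_assoc] using key .uvwxy
  · simpa [gen, mul_assoc] using key .vwxyy
  · simpa [gen, mul_assoc] using key .xyyz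

/-- Left multiplication by a generator on the space with basis all words, vanishing words being
replaced by `0`. -/
noncomputable def shift (i : Gen) : Module.End K (List Gen →₀ K) :=
  Finsupp.linearCombination K fun l => if Vanishes (i :: l) then 0 else Finsupp.single (i :: l) 1

theorem shift_single (i : Gen) (l : List Gen) :
    shift K i (Finsupp.single l 1) =
      if Vanishes (i :: l) then 0 else Finsupp.single (i :: l) 1 := by
  simp [shift]

theorem prod_shift_single (i : Gen) (l l' : List Gen) :
    ((i :: l).map (shift K)).prod (Finsupp.single l' 1) =
      if Vanishes (i :: l ++ l') then 0 else Finsupp.single (i :: l ++ l') 1 := by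
  induction l generalizing i with
  | nil => simp [shift_single]
  | cons j l ih =>
    rw [List.map_cons, List.prod_cons, Module.End.mul_apply, ih]
    split_ifs with h₁ h₂ h₂
    · simp
    · exact absurd (h₁.mono (List.suffix_cons i _).isInfix) h₂
    · simp [shift_single] at h₂ ⊢
      simp [h₂]
    · simp at h₂
      simp [shift_single, h₂]

theorem prod_shift_eq_zero {r : List Gen} (hr : r ∈ relations) :
    (r.map (shift K)).prod = 0 := by
  obtain _ | ⟨i, l⟩ := r
  · exact absurd hr (by decide)
  refine Finsupp.lhom_ext' fun l' => LinearMap.ext_ring ?_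
  have : Vanishes (i :: l ++ l') := ⟨_, hr, (List.prefix_append _ _).isInfix⟩
  rw [LinearMap.comp_apply, Finsupp.lsingle_apply, prod_shift_single, if_pos this]
  simp

theorem lift_eq_lift_of_monRel {B : Type*} [Semiring B] [Algebra K B] (f : Gen → B)
    (hf : ∀ r ∈ relations, (r.map f).prod = 0) ⦃a b : FreeAlgebra K Gen⦄ (h : MonRel K a b) :
    FreeAlgebra.lift K f a = FreeAlgebra.lift K f b := by
  simp only [relations, List.forall_mem_cons, List.map_cons, List.map_nil, List.prod_cons,
    List.prod_nil, mul_one] at hf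
  obtain ⟨h₁, h₂, h₃, h₄, h₅, h₆, h₇, h₈, h₉, -⟩ := hf
  induction h <;> simpa [g, mul_assoc]

/-- The action of `A` on the space with basis all words. -/
noncomputable def rep : A K →ₐ[K] Module.End K (List Gen →₀ K) :=
  RingQuot.liftAlgHom K ⟨FreeAlgebra.lift K (shift K),
    lift_eq_lift_of_monRel K (shift K) fun _ => prod_shift_eq_zero K⟩

theorem rep_gen (i : Gen) : rep K (gen K i) = shift K i := by
  rw [rep, gen, RingQuot.liftAlgHom_mkAlgHom_apply]
  simp [g]

/-- The coordinates of an element of `A` in the basis of non-vanishing words. -/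
noncomputable def coord : A K →ₗ[K] (List Gen →₀ K) :=
  (LinearMap.applyₗ (Finsupp.single [] 1)).comp (rep K).toLinearMap

theorem coord_word (l : List Gen) :
    coord K (word K l) = if Vanishes l then 0 else Finsupp.single l 1 := by
  have h : coord K (word K l) = (l.map (shift K)).prod (Finsupp.single [] 1) := by
    simp only [coord, word, LinearMap.comp_apply, LinearMap.applyₗ_apply_apply,
      AlgHom.toLinearMap_apply, map_list_prod, List.map_map]
    congr 3
    exact funext (rep_gen K)
  rw [h]
  obtain _ | ⟨i, l⟩ := l
  · have : ¬ Vanishes [] := by decide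
    simp [this]
  · simp only [prod_shift_single, List.append_nil]

theorem linearCombination_rep (a : A K) (f : List Gen →₀ K) :
    Finsupp.linearCombination K (word K) (rep K a f) =
      a * Finsupp.linearCombination K (word K) f := by
  obtain ⟨b, rfl⟩ := RingQuot.mkAlgHom_surjective K (MonRel K) a
  induction b using FreeAlgebra.induction generalizing f with
  | grade0 c => simp [Algebra.smul_def]
  | grade1 i =>
    change Finsupp.linearCombination K (word K) (rep K (gen K i) f) = gen K i * _
    rw [rep_gen]
    induction f using Finsupp.induction_linear with
    | zero => simp
    | add f f' h h' => simp [h, h', mul_add]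
    | single l c =>
      rw [← mul_one c, ← smul_eq_mul, ← Finsupp.smul_single, map_smul, shift_single]
      split_ifs with h
      · have := word_eq_zero K h
        rw [word_cons] at this
        simp [this]
      · simp
  | mul b b' h h' => rw [map_mul, map_mul, Module.End.mul_apply, h, h', mul_assoc]
  | add b b' h h' => simp only [map_add, LinearMap.add_apply, h, h', add_mul]

theorem linearCombination_coord (a : A K) :
    Finsupp.linearCombination K (word K) (coord K a) = a := by
  refine (linearCombination_rep K a _).trans ?_
  simp

theorem eq_zero_of_coord_eq_zero {a : A K} (h : ∀ l, coord K a l = 0) : a = 0 := by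
  rw [← linearCombination_coord K a, show coord K a = 0 from Finsupp.ext h, map_zero]

theorem coord_mul_word_append (a : A K) {l p : List Gen} (h : ¬ Vanishes (l ++ p)) :
    coord K (a * word K p) (l ++ p) = coord K a l := by
  suffices ∀ f : List Gen →₀ K,
      coord K (Finsupp.linearCombination K (word K) f * word K p) (l ++ p) = f l by
    simpa [linearCombination_coord] using this (coord K a)
  intro f
  induction f using Finsupp.induction_linear with
  | zero => simp
  | add f f' h h' => simp [h, h', add_mul]
  | single l' c =>
    rw [Finsupp.linearCombination_single, smul_mul_assoc, ← word_append, map_smul, coord_word]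
    by_cases hl : l' = l
    · subst hl
      simp [h]
    · split_ifs <;> simp [hl]

theorem coord_mul_word_of_not_suffix (a : A K) {l p : List Gen} (h : ¬ p <:+ l) :
    coord K (a * word K p) l = 0 := by
  suffices ∀ f : List Gen →₀ K,
      coord K (Finsupp.linearCombination K (word K) f * word K p) l = 0 by
    simpa [linearCombination_coord] using this (coord K a)
  intro f
  induction f using Finsupp.induction_linear with
  | zero => simp
  | add f f' h h' => simp [h, h', add_mul]
  | single l' c =>
    rw [Finsupp.linearCombination_single, smul_mul_assoc, ← word_append, map_smul, coord_word]
    have : l' ++ p ≠ l := fun hl => h (hl ▸ List.suffix_append _ _)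
    split_ifs <;> simp [this]

theorem coord_of_vanishes (a : A K) {l : List Gen} (h : Vanishes l) : coord K a l = 0 := by
  suffices ∀ f : List Gen →₀ K, coord K (Finsupp.linearCombination K (word K) f) l = 0 by
    simpa [linearCombination_coord] using this (coord K a)
  intro f
  induction f using Finsupp.induction_linear with
  | zero => simp
  | add f f' h h' => simp [h, h']
  | single l' c =>
    rw [Finsupp.linearCombination_single, map_smul, coord_word]
    split_ifs with h'
    · simp
    · have : l' ≠ l := fun hl => h' (hl ▸ h)
      simp [this]

/-- The left ideal of `A` generated by a list of words. -/
noncomputable def spanWords (ws : List (List Gen)) : Submodule (A K) (A K) :=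
  Submodule.span (A K) (word K '' {w | w ∈ ws})

theorem mem_spanWords {ws : List (List Gen)} {a : A K}
    (h : ∀ l, coord K a l ≠ 0 → ∃ w ∈ ws, w <:+ l) : a ∈ spanWords K ws := by
  rw [← linearCombination_coord K a, Finsupp.linearCombination_apply, Finsupp.sum]
  refine Submodule.sum_mem _ fun l hl => Submodule.smul_of_tower_mem _ _ ?_
  obtain ⟨w, hw, l', rfl⟩ := h l (Finsupp.mem_support_iff.1 hl)
  rw [word_append]
  exact Submodule.smul_mem _ _ (Submodule.subset_span ⟨w, hw, rfl⟩)

theorem exists_suffix_of_mem_spanWords {ws : List (List Gen)} {a : A K} (ha : a ∈ spanWords K ws)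
    {l : List Gen} (hl : coord K a l ≠ 0) : ∃ w ∈ ws, w <:+ l := by
  by_contra! h
  refine hl ?_
  induction ha using Submodule.closure_induction with
  | zero => simp
  | add a b _ _ iha ihb =>
    rw [map_add, Finsupp.add_apply]
    by_cases h₁ : coord K a l = 0
    · by_cases h₂ : coord K b l = 0
      · simp [h₁, h₂]
      · exact absurd (ihb h₂) h₂
    · exact absurd (iha h₁) h₁
  | smul_mem a x hx =>
    obtain ⟨w, hw, rfl⟩ := hx
    exact coord_mul_word_of_not_suffix K a (h w hw)

theorem hasProjectiveDimensionLT_spanWords (k : ℕ) {ws : List (List Gen)}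
    (hws : ws.Pairwise fun a b => ¬ a <:+ b ∧ ¬ b <:+ a)
    (h : ∀ w ∈ ws, HasProjectiveDimensionLT (ModuleCat.of (A K) (spanWords K [w])) k) :
    HasProjectiveDimensionLT (ModuleCat.of (A K) (spanWords K ws)) k := by
  induction ws with
  | nil =>
    have : Subsingleton (spanWords K []) := by
      simp only [spanWords, List.not_mem_nil, Set.ofPred_false, Set.image_empty,
        Submodule.span_empty]
      infer_instance
    have := (hasProjectiveDimensionLT_zero_iff_isZero
      (X := ModuleCat.of (A K) (spanWords K []))).2 (ModuleCat.isZero_of_subsingleton _)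
    exact hasProjectiveDimensionLT_of_ge _ 0 k (by lia)
  | cons w ws ih =>
    rw [List.pairwise_cons] at hws
    have h₁ := h w (by simp)
    have h₂ := ih hws.2 fun w' hw' => h w' (by simp [hw'])
    have hsup : spanWords K (w :: ws) = spanWords K [w] ⊔ spanWords K ws := by
      rw [spanWords, spanWords, spanWords, ← Submodule.span_union, ← Set.image_union]
      congr 2
      ext
      simp
    have hdisj : Disjoint (spanWords K [w]) (spanWords K ws) := by
      rw [Submodule.disjoint_def]
      intro a ha ha'
      refine eq_zero_of_coord_eq_zero K fun l => ?_
      by_contra hl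
      obtain ⟨w₁, hw₁, hl₁⟩ := exists_suffix_of_mem_spanWords K ha hl
      obtain ⟨w₂, hw₂, hl₂⟩ := exists_suffix_of_mem_spanWords K ha' hl
      obtain rfl : w₁ = w := by simpa using hw₁
      exact (List.suffix_or_suffix_of_suffix hl₁ hl₂).elim (hws.1 _ hw₂).1 (hws.1 _ hw₂).2
    rw [hsup]
    exact hasProjectiveDimensionLT_sup _ _ hdisj k

/-- The words in `ws` are pairwise incomparable for the suffix order, they annihilate the
non-vanishing word `p` on the left, and every non-vanishing word doing so ends in one of them. -/
def IsAnnihilator (p : List Gen) (ws : List (List Gen)) : Prop :=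
  ¬ Vanishes p ∧ (ws.Pairwise fun a b => ¬ a <:+ b ∧ ¬ b <:+ a) ∧
    (∀ w ∈ ws, Vanishes (w ++ p)) ∧
    ∀ r ∈ relations, ∀ k ∈ List.range r.length, r.drop k <+: p → ∃ w ∈ ws, w <:+ r.take k

instance (p : List Gen) (ws : List (List Gen)) : Decidable (IsAnnihilator p ws) :=
  inferInstanceAs (Decidable (_ ∧ _))

theorem IsAnnihilator.exists_suffix {p : List Gen} {ws : List (List Gen)}
    (h : IsAnnihilator p ws) {l : List Gen} (hl : ¬ Vanishes l) (hlp : Vanishes (l ++ p)) :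
    ∃ w ∈ ws, w <:+ l := by
  obtain ⟨r, hr, hrl⟩ := hlp
  obtain hrl | hrl | ⟨a, b, rfl, ha, hb⟩ := List.infix_append_iff.1 hrl
  · exact absurd ⟨r, hr, hrl⟩ hl
  · exact absurd ⟨r, hr, hrl⟩ h.1
  · obtain rfl | hb' := eq_or_ne b []
    · exact absurd ⟨_, hr, by simpa using ha.isInfix⟩ hl
    · obtain ⟨w, hw, hwa⟩ := h.2.2.2 _ hr a.length
        (by simpa [List.length_pos_iff] using hb') (by simpa using hb)
      exact ⟨w, hw, (by simpa using hwa : w <:+ a).trans ha⟩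

theorem IsAnnihilator.ker_eq {p : List Gen} {ws : List (List Gen)} (h : IsAnnihilator p ws) :
    LinearMap.ker (LinearMap.toSpanSingleton (A K) (A K) (word K p)) = spanWords K ws := by
  refine le_antisymm (fun a ha => mem_spanWords K fun l hl => ?_) (Submodule.span_le.2 ?_)
  · have ha : a * word K p = 0 := ha
    refine h.exists_suffix (fun hv => hl (coord_of_vanishes K a hv)) ?_
    by_contra hv
    exact hl (by rw [← coord_mul_word_append K a hv, ha, map_zero, Finsupp.zero_apply])
  · rintro _ ⟨w, hw, rfl⟩
    change word K w * word K p = 0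
    rw [← word_append, word_eq_zero K (h.2.2.1 w hw)]

theorem IsAnnihilator.hasProjectiveDimensionLT {p : List Gen} {ws : List (List Gen)}
    (h : IsAnnihilator p ws) {k : ℕ}
    (hws : ∀ w ∈ ws, HasProjectiveDimensionLT (ModuleCat.of (A K) (spanWords K [w])) k) :
    HasProjectiveDimensionLT (ModuleCat.of (A K) (spanWords K [p])) (k + 1) := by
  have hrange : LinearMap.range (LinearMap.toSpanSingleton (A K) (A K) (word K p)) =
      spanWords K [p] := by
    simp [spanWords, LinearMap.range_toSpanSingleton]
  rw [← hrange]
  refine hasProjectiveDimensionLT_of_ker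
    (LinearMap.toSpanSingleton (A K) (A K) (word K p)).rangeRestrict
    (LinearMap.surjective_rangeRestrict _) k ?_
  rw [LinearMap.ker_rangeRestrict, h.ker_eq K]
  exact hasProjectiveDimensionLT_spanWords K k h.2.1 hws

theorem aug_word_cons (i : Gen) (l : List Gen) : aug K (word K (i :: l)) = 0 := by
  have : aug K (gen K i) = 0 := by
    rw [aug, gen, RingQuot.liftAlgHom_mkAlgHom_apply]
    simp [g]
  simp [this]

theorem aug_eq_coord_nil (a : A K) : aug K a = coord K a [] := by
  suffices ∀ f : List Gen →₀ K, aug K (Finsupp.linearCombination K (word K) f) =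
      coord K (Finsupp.linearCombination K (word K) f) [] by
    simpa [linearCombination_coord] using this (coord K a)
  intro f
  induction f using Finsupp.induction_linear with
  | zero => simp
  | add f f' h h' => simp [h, h']
  | single l c =>
    rw [Finsupp.linearCombination_single, map_smul, map_smul, coord_word]
    obtain _ | ⟨i, l⟩ := l
    · have : ¬ Vanishes [] := by decide
      simp [this]
    · rw [aug_word_cons]
      split_ifs <;> simp

/-- The one-letter words. -/
def letters : List (List Gen) :=
  [[m], [n], [p], [q], [r], [s], [t], [u], [v], [w], [x], [y], [z]]

theorem aug_eq_zero_iff (a : A K) : aug K a = 0 ↔ a ∈ spanWords K letters := by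
  rw [aug_eq_coord_nil]
  refine ⟨fun ha => mem_spanWords K fun l hl => ?_, fun ha => ?_⟩
  · obtain rfl | ⟨l, i, rfl⟩ := List.eq_nil_or_concat' l
    · exact absurd ha hl
    · exact ⟨[i], by cases i <;> decide, List.suffix_append _ _⟩
  · by_contra hl
    obtain ⟨w, hw, h⟩ := exists_suffix_of_mem_spanWords K ha hl
    rw [List.suffix_nil.1 h] at hw
    exact absurd hw (by decide)

theorem hasProjectiveDimensionLT_KMod {k : ℕ}
    (h : ∀ w ∈ letters, HasProjectiveDimensionLT (ModuleCat.of (A K) (spanWords K [w])) k) :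
    HasProjectiveDimensionLT (KMod K) (k + 1) := by
  let : Module (A K) K := Module.compHom K (aug K).toRingHom
  let f : A K →ₗ[A K] K :=
    { toFun := aug K
      map_add' := map_add _
      map_smul' := fun a b => map_mul (aug K) a b }
  have hf : Function.Surjective f := fun c => ⟨algebraMap K (A K) c, (aug K).commutes c⟩
  have hker : LinearMap.ker f = spanWords K letters := by
    ext a
    exact aug_eq_zero_iff K a
  refine hasProjectiveDimensionLT_of_ker f hf k ?_
  rw [hker]
  exact hasProjectiveDimensionLT_spanWords K k (by decide) h

/-- The minimal words annihilating the word `p` on the left because of an overlap of `p` with one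
of the defining monomials. -/
def annihilators (p : List Gen) : List (List Gen) :=
  let ws := relations.flatMap fun r =>
    ((List.range r.length).filter fun k => r.drop k <+: p).map fun k => r.take k
  (ws.filter fun w => ∀ w' ∈ ws, w' <:+ w → w' = w).dedup

/-- Iterating `annihilators` starting from a word stops after fewer than `k` steps. -/
def HasBound : ℕ → List Gen → Prop
  | 0, _ => False
  | k + 1, l => IsAnnihilator l (annihilators l) ∧ ∀ w ∈ annihilators l, HasBound k w

instance HasBound.decidable : ∀ (k : ℕ) (p : List Gen), Decidable (HasBound k p)
  | 0, _ => inferInstanceAs (Decidable False)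
  | k + 1, _ =>
    have := HasBound.decidable k
    inferInstanceAs (Decidable (_ ∧ _))

theorem HasBound.hasProjectiveDimensionLT {k : ℕ} {p : List Gen} (h : HasBound k p) :
    HasProjectiveDimensionLT (ModuleCat.of (A K) (spanWords K [p])) k := by
  induction k generalizing p with
  | zero => exact h.elim
  | succ k ih => exact h.1.hasProjectiveDimensionLT K fun w hw => ih (h.2 w hw)

theorem hasBound_of_mem_letters : ∀ p ∈ letters, HasBound 6 p := by
  decide +kernel

end MonomialAlgebra

/-- `Extᴬⁿ(K,K) = 0` for all `n ≥ 7`. -/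
theorem statement_1 (n : ℕ) (hn : 7 ≤ n) : Subsingleton (extKK K n) := by
  obtain ⟨m, rfl⟩ : ∃ m, n = m + 1 := ⟨n - 1, by lia⟩
  have := MonomialAlgebra.hasProjectiveDimensionLT_KMod K fun w hw =>
    (MonomialAlgebra.hasBound_of_mem_letters w hw).hasProjectiveDimensionLT K
  exact ModuleCat.subsingleton_of_isZero
    (isZero_Ext_of_hasProjectiveDimensionLT (KMod K) (KMod K) 7 m hn)
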